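/- Let c > p−1 be fixed and a_n → ∞. If X_n ~ Beta_p(c, a_n), then a_n X_n converges in distribution to the complex Wishart distribution W_p(c). -/

import Mathlib

open MeasureTheory Filter
open scoped ComplexOrder ENNReal Topology

attribute [local instance] Classical.propDecidable

noncomputable instance matrixMeasureSpace (p : ℕ) : MeasureSpace (Matrix (Fin p) (Fin p) ℂ) :=
  inferInstanceAs (MeasureSpace (Fin p → Fin p → ℂ))

/-- Parametrization of Hermitian matrices by their diagonal (real) entries and their
strictly upper triangular (complex) entries. -/
noncomputable def hermMk (p : ℕ)
    (x : (Fin p → ℝ) × ({q : Fin p × Fin p // q.1 < q.2} → ℂ)) :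
    Matrix (Fin p) (Fin p) ℂ :=
  Matrix.of fun i j =>
    if h : i < j then x.2 ⟨(i, j), h⟩
    else if h' : j < i then star (x.2 ⟨(j, i), h'⟩)
    else (x.1 i : ℂ)

/-- Lebesgue measure `∏_{i ≤ j} dx_{ij}^Re ∏_{i < j} dx_{ij}^Im` on the set of
Hermitian `p × p` complex matrices. -/
noncomputable def hermLebesgue (p : ℕ) : Measure (Matrix (Fin p) (Fin p) ℂ) :=
  Measure.map (hermMk p) volume

/-- Normalization of a measure into a probability measure. -/
noncomputable def mnormalize {α : Type*} [MeasurableSpace α] (μ : Measure α) : Measure α :=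
  (μ Set.univ)⁻¹ • μ

/-- The complex matrix Beta distribution `Beta_p(α, β)`, with density proportional to
`det(X)^(α-p) det(I-X)^(β-p)` on Hermitian matrices `0 < X < I`. -/
noncomputable def matrixBeta (p : ℕ) (α β : ℝ) : Measure (Matrix (Fin p) (Fin p) ℂ) :=
  mnormalize <| (hermLebesgue p).withDensity fun X =>
    if X.PosDef ∧ ((1 : Matrix (Fin p) (Fin p) ℂ) - X).PosDef then
      ENNReal.ofReal (Real.rpow X.det.re (α - p) * Real.rpow (1 - X).det.re (β - p))
    else 0

/-- The complex Wishart distribution `W_p(a)`, with density proportional to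
`det(X)^(a-p) e^(-tr X)` on positive definite Hermitian matrices. -/
noncomputable def wishart (p : ℕ) (a : ℝ) : Measure (Matrix (Fin p) (Fin p) ℂ) :=
  mnormalize <| (hermLebesgue p).withDensity fun X =>
    if X.PosDef then
      ENNReal.ofReal (Real.rpow X.det.re (a - p) * Real.exp (-X.trace.re))
    else 0

/-- The Gaussian Unitary Ensemble `GUE_p`, with density proportional to `exp(-tr(X²)/2)`
on Hermitian matrices. -/
noncomputable def gue (p : ℕ) : Measure (Matrix (Fin p) (Fin p) ℂ) :=
  mnormalize <| (hermLebesgue p).withDensity fun X =>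
    ENNReal.ofReal (Real.exp (-(X * X).trace.re / 2))

/-- Convergence in distribution of a sequence of laws to a limiting law. -/
def TendstoInDistribution {M : Type*} [MeasurableSpace M] [TopologicalSpace M]
    (μ : ℕ → Measure M) (ν : Measure M) : Prop :=
  ∀ f : BoundedContinuousFunction M ℝ,
    Tendsto (fun n => ∫ x, f x ∂(μ n)) atTop (𝓝 (∫ x, f x ∂ν))

/-- A sequence of measures satisfies a large deviation principle with speed `n` and good
rate function `I`: `I` is lower semicontinuous with compact sublevel sets, and for every
Borel set `A`,
`-inf_{Int A} I ≤ liminf (1/n) log μ_n(A) ≤ limsup (1/n) log μ_n(A) ≤ -inf_{Clo A} I`. -/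
def IsLDP {α : Type*} [TopologicalSpace α] [MeasurableSpace α]
    (μ : ℕ → Measure α) (I : α → EReal) : Prop :=
  LowerSemicontinuous I ∧ (∀ c : ℝ, IsCompact {x | I x ≤ (c : EReal)}) ∧
  ∀ A : Set α, MeasurableSet A →
    (-(⨅ x ∈ interior A, I x) ≤
        liminf (fun n : ℕ => (((n : ℝ)⁻¹ : ℝ) : EReal) * (μ n A).log) atTop ∧
      limsup (fun n : ℕ => (((n : ℝ)⁻¹ : ℝ) : EReal) * (μ n A).log) atTop ≤
        -(⨅ x ∈ closure A, I x))

instance matrixBorelSpace (p : ℕ) : BorelSpace (Matrix (Fin p) (Fin p) ℂ) :=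
  inferInstanceAs (BorelSpace (Fin p → Fin p → ℂ))

lemma isOpen_setOf_forall_quadraticForm_pos (p : ℕ) :
    IsOpen {X : Matrix (Fin p) (Fin p) ℂ |
      ∀ v ∈ Metric.sphere (0 : EuclideanSpace ℂ (Fin p)) 1,
        0 < (dotProduct (star v.ofLp) (X.mulVec v.ofLp)).re} := by
  rw [isOpen_iff_mem_nhds]
  intro X hX
  refine (isCompact_sphere _ _).eventually_forall_of_forall_eventually fun v hv => ?_
  have h2 : Continuous fun z : Matrix (Fin p) (Fin p) ℂ × EuclideanSpace ℂ (Fin p) =>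
      z.2.ofLp := (PiLp.continuous_ofLp 2 _).comp continuous_snd
  exact (Complex.continuous_re.comp
    (Continuous.dotProduct h2.star (continuous_fst.matrix_mulVec h2))).continuousAt.eventually_const_lt
    (hX v hv)

lemma posDef_iff_forall_sphere {p : ℕ} {X : Matrix (Fin p) (Fin p) ℂ} (hX : X.IsHermitian) :
    X.PosDef ↔ ∀ v ∈ Metric.sphere (0 : EuclideanSpace ℂ (Fin p)) 1,
        0 < (dotProduct (star v.ofLp) (X.mulVec v.ofLp)).re := by
  constructor
  · intro h v hv
    refine (Complex.pos_iff.1 (h.dotProduct_mulVec_pos (x := v.ofLp) ?_)).1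
    intro h0
    have : v = 0 := by ext i; simpa using congrFun h0 i
    simp [this] at hv
  · intro h
    refine Matrix.PosDef.of_dotProduct_mulVec_pos hX fun x hx => ?_
    set v : EuclideanSpace ℂ (Fin p) := WithLp.toLp 2 x with hv
    have hv0 : v ≠ 0 := fun h0 => hx (by simpa [hv] using congrArg WithLp.ofLp h0)
    have hn : (0 : ℝ) < ‖v‖ := norm_pos_iff.2 hv0
    have key := h (((‖v‖⁻¹ : ℝ) : ℂ) • v) (by
      simp [norm_smul, hn.ne'])
    have him : (dotProduct (star x) (X.mulVec x)).im = 0 := hX.im_star_dotProduct_mulVec_self x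
    rw [Complex.pos_iff]
    refine ⟨?_, him.symm⟩
    have e : dotProduct (star (((‖v‖⁻¹ : ℝ) : ℂ) • v).ofLp)
        (X.mulVec (((‖v‖⁻¹ : ℝ) : ℂ) • v).ofLp)
        = (((‖v‖⁻¹ * ‖v‖⁻¹ : ℝ)) : ℂ) * dotProduct (star x) (X.mulVec x) := by
      simp [hv, Matrix.mulVec_smul, mul_assoc]
    rw [e, Complex.re_ofReal_mul] at key
    exact pos_of_mul_pos_right key (by positivity)

lemma measurableSet_posDef (p : ℕ) :
    MeasurableSet {X : Matrix (Fin p) (Fin p) ℂ | X.PosDef} := by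
  have : {X : Matrix (Fin p) (Fin p) ℂ | X.PosDef} = {X | X.IsHermitian} ∩
      {X | ∀ v ∈ Metric.sphere (0 : EuclideanSpace ℂ (Fin p)) 1,
        0 < (dotProduct (star v.ofLp) (X.mulVec v.ofLp)).re} := by
    ext X
    exact ⟨fun h => ⟨h.isHermitian, (posDef_iff_forall_sphere h.isHermitian).1 h⟩,
      fun h => (posDef_iff_forall_sphere h.1).2 h.2⟩
  rw [this]
  refine MeasurableSet.inter (IsClosed.measurableSet ?_)
    (isOpen_setOf_forall_quadraticForm_pos p).measurableSet
  exact isClosed_eq continuous_id.matrix_conjTranspose continuous_id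

lemma eventually_posDef {α : Type*} {l : Filter α} {p : ℕ} {F : α → Matrix (Fin p) (Fin p) ℂ}
    {X : Matrix (Fin p) (Fin p) ℂ} (hF : ∀ a, (F a).IsHermitian) (h : Tendsto F l (𝓝 X))
    (hX : X.PosDef) : ∀ᶠ a in l, (F a).PosDef := by
  filter_upwards [h.eventually ((isOpen_setOf_forall_quadraticForm_pos p).mem_nhds
    ((posDef_iff_forall_sphere hX.isHermitian).1 hX))] with a ha
  exact (posDef_iff_forall_sphere (hF a)).2 ha

lemma det_re_pos {p : ℕ} {X : Matrix (Fin p) (Fin p) ℂ} (h : X.PosDef) : 0 < X.det.re :=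
  (Complex.pos_iff.1 h.det_pos).1

lemma ofReal_det_re {p : ℕ} {X : Matrix (Fin p) (Fin p) ℂ} (h : X.PosDef) :
    ((X.det.re : ℝ) : ℂ) = X.det :=
  Complex.ext rfl (Complex.pos_iff.1 h.det_pos).2

lemma diag_re_pos {p : ℕ} {X : Matrix (Fin p) (Fin p) ℂ} (h : X.PosDef) (i : Fin p) :
    0 < (X i i).re :=
  (Complex.pos_iff.1 h.diag_pos).1

lemma det_re_le_exp {p : ℕ} {X : Matrix (Fin p) (Fin p) ℂ} (h : X.PosDef) :
    X.det.re ≤ Real.exp ((X - 1).trace.re) := by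
  have h1 : X.det.re = ∏ i, h.isHermitian.eigenvalues i := by
    rw [h.isHermitian.det_eq_prod_eigenvalues]
    simp [← Complex.ofReal_prod]
  have h2 : (X - 1).trace.re = ∑ i, (h.isHermitian.eigenvalues i - 1) := by
    rw [Matrix.trace_sub, h.isHermitian.trace_eq_sum_eigenvalues]
    simp
  rw [h1, h2, Real.exp_sum]
  refine Finset.prod_le_prod (fun i _ => (h.eigenvalues_pos i).le) fun i _ => ?_
  simpa using Real.add_one_le_exp (h.isHermitian.eigenvalues i - 1)

lemma norm_apply_le_trace {p : ℕ} {X : Matrix (Fin p) (Fin p) ℂ} (h : X.PosDef) {i j : Fin p}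
    (hij : i ≠ j) : ‖X i j‖ ≤ X.trace.re := by
  have hinj : Function.Injective ![i, j] := by
    intro a b hab
    fin_cases a <;> fin_cases b <;> simp_all
  have hd := det_re_pos (h.submatrix hinj)
  have hji : X j i = star (X i j) := (h.isHermitian.apply j i).symm
  have hii := h.diag_pos (i := i)
  have hjj := h.diag_pos (i := j)
  rw [Complex.pos_iff] at hii hjj
  rw [Matrix.det_fin_two] at hd
  simp only [Matrix.submatrix_apply, Matrix.cons_val_zero, Matrix.cons_val_one, hji,
    Complex.sub_re, Complex.mul_re, ← hii.2, ← hjj.2] at hd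
  have htr : (X i i).re + (X j j).re ≤ X.trace.re := by
    have : X.trace.re = ∑ k, (X k k).re := by simp [Matrix.trace]
    rw [this, ← Finset.sum_pair hij (f := fun k => (X k k).re)]
    exact Finset.sum_le_sum_of_subset_of_nonneg (Finset.subset_univ _)
      fun k _ _ => (diag_re_pos h k).le
  have hn : ‖X i j‖ ^ 2 = (X i j).re * (X i j).re + (X i j).im * (X i j).im := by
    rw [← Complex.normSq_eq_norm_sq, Complex.normSq_apply]
  simp at hd
  refine le_trans ?_ htr
  refine abs_le_of_sq_le_sq' ?_ (by linarith [hii.1, hjj.1]) |>.2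
  nlinarith [hii.1, hjj.1]

/-- The matrix with real diagonal `d` and off-diagonal entries those of `z`. -/
noncomputable def fillDiag {n : ℕ} (d : Fin n → ℝ) (z : Matrix (Fin n) (Fin n) ℂ) :
    Matrix (Fin n) (Fin n) ℂ :=
  Matrix.of fun i j => if i = j then (d i : ℂ) else z i j

lemma fillDiag_submatrix {n : ℕ} (d : Fin (n + 1) → ℝ)
    (z : Matrix (Fin (n + 1)) (Fin (n + 1)) ℂ) :
    (fillDiag d z).submatrix Fin.castSucc Fin.castSucc =
      fillDiag (fun i => d i.castSucc) (z.submatrix Fin.castSucc Fin.castSucc) := by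
  ext i j
  simp [fillDiag]

lemma exists_schur_complement {n : ℕ} (D : Fin n → ℝ) (z : Matrix (Fin (n + 1)) (Fin (n + 1)) ℂ) :
    ∃ q : ℝ, 0 ≤ q ∧ ∀ d : Fin (n + 1) → ℝ, (∀ i, d (Fin.castSucc i) = D i) →
      (fillDiag d z).PosDef →
        (fillDiag D (z.submatrix Fin.castSucc Fin.castSucc)).PosDef ∧ q < d (Fin.last n) ∧
        (fillDiag d z).det.re =
          (fillDiag D (z.submatrix Fin.castSucc Fin.castSucc)).det.re * (d (Fin.last n) - q) := by
  set A := fillDiag D (z.submatrix Fin.castSucc Fin.castSucc) with hA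
  have hsub : ∀ d : Fin (n + 1) → ℝ, (∀ i, d (Fin.castSucc i) = D i) → (fillDiag d z).PosDef →
      A.PosDef := by
    intro d hd h
    have := h.submatrix (Fin.castSucc_injective n)
    rwa [fillDiag_submatrix, funext hd] at this
  by_cases hAp : A.PosDef
  swap
  · exact ⟨0, le_rfl, fun d hd h => absurd (hsub d hd h) hAp⟩
  set b : Fin n → ℂ := fun i => z i.castSucc (Fin.last n) with hb
  set w : ℂ := dotProduct (star b) (A⁻¹.mulVec b) with hw
  have hw0 : 0 ≤ w := hAp.inv.posSemidef.dotProduct_mulVec_nonneg b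
  rw [Complex.nonneg_iff] at hw0
  refine ⟨w.re, hw0.1, fun d hd h => ⟨hAp, ?_⟩⟩
  have hdet : (fillDiag d z).det = A.det * ((d (Fin.last n) : ℂ) - w) := by
    have hAu : IsUnit A := hAp.isUnit
    let := hAu.invertible
    rw [← Matrix.det_submatrix_equiv_self (finSumFinEquiv (m := n) (n := 1)) (fillDiag d z),
      ← Matrix.fromBlocks_toBlocks ((fillDiag d z).submatrix finSumFinEquiv finSumFinEquiv)]
    have h11 : ((fillDiag d z).submatrix (finSumFinEquiv (m := n) (n := 1))
        finSumFinEquiv).toBlocks₁₁ = A := by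
      rw [hA, ← funext hd, ← fillDiag_submatrix]
      rfl
    rw [h11, Matrix.det_fromBlocks₁₁, Matrix.det_fin_one (_ - _)]
    congr 1
    rw [Matrix.sub_apply]
    congr 1
    · simp [Matrix.toBlocks₂₂, fillDiag]
      rfl
    · rw [Matrix.invOf_eq_nonsing_inv, Matrix.mul_assoc, hw, Matrix.mul_apply']
      congr 1
      · ext i
        have := h.isHermitian.apply (Fin.last n) i.castSucc
        have hne : Fin.castSucc i ≠ Fin.last n := (Fin.castSucc_lt_last i).ne
        have h2 : fillDiag d z i.castSucc (Fin.last n) = b i := by simp [fillDiag, hne, hb]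
        rw [h2] at this
        exact this.symm
      · ext i
        rw [Matrix.mul_apply', Matrix.mulVec]
        congr 1
        ext k
        have hne : Fin.castSucc k ≠ Fin.last n := (Fin.castSucc_lt_last k).ne
        have h2 : fillDiag d z k.castSucc (Fin.last n) = b k := by simp [fillDiag, hne, hb]
        exact h2
  have hre : (fillDiag d z).det.re = A.det.re * (d (Fin.last n) - w.re) := by
    rw [hdet, ← ofReal_det_re hAp, Complex.re_ofReal_mul]
    simp
  refine ⟨?_, hre⟩
  have := det_re_pos h
  rw [hre] at this
  linarith [pos_of_mul_pos_right this (det_re_pos hAp).le]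

/-- The unnormalized Wishart-type density `det(X)^s e^(-t tr X)` on positive definite matrices. -/
noncomputable def wishartWeight (p : ℕ) (s t : ℝ) (X : Matrix (Fin p) (Fin p) ℂ) : ℝ :=
  if X.PosDef then X.det.re ^ s * Real.exp (-(t * X.trace.re)) else 0

lemma wishartWeight_nonneg (p : ℕ) (s t : ℝ) (X : Matrix (Fin p) (Fin p) ℂ) :
    0 ≤ wishartWeight p s t X := by
  unfold wishartWeight
  split_ifs with h
  · have := det_re_pos h
    positivity
  · exact le_rfl

lemma measurable_det_re (p : ℕ) :
    Measurable fun X : Matrix (Fin p) (Fin p) ℂ => X.det.re :=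
  (Complex.continuous_re.comp continuous_id.matrix_det).measurable

lemma measurable_trace_re (p : ℕ) :
    Measurable fun X : Matrix (Fin p) (Fin p) ℂ => X.trace.re :=
  (Complex.continuous_re.comp continuous_id.matrix_trace).measurable

lemma measurable_wishartWeight (p : ℕ) (s t : ℝ) : Measurable (wishartWeight p s t) :=
  Measurable.ite (measurableSet_posDef p)
    (((measurable_det_re p).pow_const s).mul
      ((measurable_trace_re p).const_mul t).neg.exp) measurable_const

lemma measurable_fillDiag {n : ℕ} (z : Matrix (Fin n) (Fin n) ℂ) :
    Measurable fun d : Fin n → ℝ => fillDiag d z := by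
  refine Continuous.measurable (continuous_matrix fun i j => ?_)
  by_cases h : i = j
  · simp only [fillDiag, h, Matrix.of_apply, if_true]
    exact Complex.continuous_ofReal.comp (continuous_apply j)
  · simp only [fillDiag, h, Matrix.of_apply, if_false]
    exact continuous_const

lemma trace_fillDiag_re {n : ℕ} (d : Fin n → ℝ) (z : Matrix (Fin n) (Fin n) ℂ) :
    (fillDiag d z).trace.re = ∑ i, d i := by
  simp [Matrix.trace, fillDiag]

lemma exists_lintegral_shifted_gamma_le {s t : ℝ} (hs : -1 < s) (ht : 0 < t) :
    ∃ C : ℝ≥0∞, C ≠ ∞ ∧ ∀ q : ℝ, 0 ≤ q →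
      ∫⁻ x : ℝ, (if q < x then ENNReal.ofReal ((x - q) ^ s * Real.exp (-(t * x))) else 0) ≤ C := by
  have hint := integrableOn_rpow_mul_exp_neg_mul_rpow hs zero_lt_one ht
  refine ⟨∫⁻ x in Set.Ioi (0 : ℝ), ENNReal.ofReal (x ^ s * Real.exp (-t * x ^ (1 : ℝ))), ?_, ?_⟩
  · exact hint.lintegral_lt_top.ne
  · intro q hq
    rw [← lintegral_indicator measurableSet_Ioi]
    refine le_trans (lintegral_mono fun x => ?_) (lintegral_sub_right_eq_self _ q).le
    by_cases h : q < x
    · have h' : x - q ∈ Set.Ioi (0 : ℝ) := by simpa using h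
      rw [if_pos h, Set.indicator_of_mem h']
      refine ENNReal.ofReal_le_ofReal (mul_le_mul_of_nonneg_left (Real.exp_le_exp.2 ?_)
        (Real.rpow_nonneg (sub_pos.2 h).le _))
      rw [Real.rpow_one]
      nlinarith
    · simp [h]

lemma lintegral_fillDiag_le {s t : ℝ} {C : ℝ≥0∞}
    (hC : ∀ q : ℝ, 0 ≤ q →
      ∫⁻ x : ℝ, (if q < x then ENNReal.ofReal ((x - q) ^ s * Real.exp (-(t * x))) else 0) ≤ C)
    (n : ℕ) (z : Matrix (Fin n) (Fin n) ℂ) :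
    ∫⁻ d : Fin n → ℝ, ENNReal.ofReal (wishartWeight n s t (fillDiag d z)) ≤ C ^ n := by
  induction n with
  | zero =>
    rw [volume_pi, Measure.pi_of_empty, lintegral_dirac]
    unfold wishartWeight
    split_ifs <;> simp
  | succ n ih =>
    set e := MeasurableEquiv.piFinSuccAbove (fun _ : Fin (n + 1) => ℝ) (Fin.last n)
    have hmeas : Measurable fun d : Fin (n + 1) → ℝ =>
        ENNReal.ofReal (wishartWeight (n + 1) s t (fillDiag d z)) :=
      ((measurable_wishartWeight _ s t).comp (measurable_fillDiag z)).ennreal_ofReal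
    have hmeas' : Measurable fun a : ℝ × (Fin n → ℝ) =>
        ENNReal.ofReal (wishartWeight (n + 1) s t (fillDiag
          ((MeasurableEquiv.piFinSuccAbove (fun _ : Fin (n + 1) => ℝ) (Fin.last n)).symm a) z)) :=
      hmeas.comp (MeasurableEquiv.measurable _)
    rw [← (volume_preserving_piFinSuccAbove (fun _ : Fin (n + 1) => ℝ)
      (Fin.last n)).symm.lintegral_comp hmeas, Measure.volume_eq_prod,
      lintegral_prod_symm' _ hmeas']
    calc _ ≤ ∫⁻ D : Fin n → ℝ, ENNReal.ofReal
              (wishartWeight n s t (fillDiag D (z.submatrix Fin.castSucc Fin.castSucc))) * C := ?_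
      _ ≤ C ^ n * C := by
          rw [lintegral_mul_const]
          · exact mul_le_mul_left (ih _) _
          · exact ((measurable_wishartWeight _ s t).comp (measurable_fillDiag _)).ennreal_ofReal
      _ = C ^ (n + 1) := (pow_succ _ _).symm
    refine lintegral_mono fun D => ?_
    obtain ⟨q, hq, H⟩ := exists_schur_complement D z
    refine le_trans ?_ (mul_le_mul_right (hC q hq) _)
    rw [← lintegral_const_mul' _ _ ENNReal.ofReal_ne_top]
    refine lintegral_mono fun x => ?_
    set d : Fin (n + 1) → ℝ := e.symm (x, D) with hd
    have hlast : d (Fin.last n) = x := by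
      simp [hd, e, MeasurableEquiv.piFinSuccAbove]
    have hcast : ∀ i, d (Fin.castSucc i) = D i := by
      intro i
      simp [hd, e, MeasurableEquiv.piFinSuccAbove]
    change ENNReal.ofReal (wishartWeight (n + 1) s t (fillDiag d z)) ≤ _
    by_cases h : (fillDiag d z).PosDef
    · obtain ⟨hA, hqx, hdet⟩ := H d hcast h
      rw [hlast] at hqx hdet
      rw [if_pos hqx, ← ENNReal.ofReal_mul (wishartWeight_nonneg _ _ _ _)]
      refine ENNReal.ofReal_le_ofReal (le_of_eq ?_)
      rw [wishartWeight, if_pos h, wishartWeight, if_pos hA, hdet,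
        Real.mul_rpow (det_re_pos hA).le (sub_pos.2 hqx).le, trace_fillDiag_re, trace_fillDiag_re,
        Fin.sum_univ_castSucc, hlast]
      simp_rw [hcast]
      rw [mul_add, neg_add, Real.exp_add]
      ring
    · simp [wishartWeight, h]

lemma hermMk_eq_fillDiag (p : ℕ) (x : (Fin p → ℝ) × ({q : Fin p × Fin p // q.1 < q.2} → ℂ)) :
    hermMk p x = fillDiag x.1 (hermMk p (0, x.2)) := by
  ext i j
  rcases lt_trichotomy i j with h | h | h
  · simp [hermMk, fillDiag, h, h.ne]
  · simp [hermMk, fillDiag, h]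
  · simp [hermMk, fillDiag, h, h.ne', h.not_gt]

lemma continuous_hermMk (p : ℕ) : Continuous (hermMk p) := by
  refine continuous_matrix fun i j => ?_
  rcases lt_trichotomy i j with h | h | h
  · simp only [hermMk, Matrix.of_apply, h, dite_true]
    fun_prop
  · simp only [hermMk, Matrix.of_apply, h, lt_irrefl, dite_false]
    fun_prop
  · simp only [hermMk, Matrix.of_apply, h, h.not_gt, dite_false, dite_true]
    fun_prop

lemma isHermitian_hermMk (p : ℕ) (x : (Fin p → ℝ) × ({q : Fin p × Fin p // q.1 < q.2} → ℂ)) :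
    (hermMk p x).IsHermitian := by
  refine Matrix.IsHermitian.ext fun i j => ?_
  rcases lt_trichotomy i j with h | h | h
  · simp [hermMk, h, h.not_gt]
  · simp [hermMk, h]
  · simp [hermMk, h, h.not_gt]

lemma hermMk_smul (p : ℕ) (r : ℝ)
    (x : (Fin p → ℝ) × ({q : Fin p × Fin p // q.1 < q.2} → ℂ)) :
    hermMk p (r • x) = r • hermMk p x := by
  ext i j
  rcases lt_trichotomy i j with h | h | h
  · simp [hermMk, h]
  · simp [hermMk, h]
  · simp [hermMk, h, h.not_gt]

lemma integrable_exp_neg_mul_norm {δ : ℝ} (hδ : 0 < δ) :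
    Integrable fun z : ℂ => Real.exp (-(δ * ‖z‖)) := by
  have h := Complex.integral_exp_neg_mul_rpow le_rfl hδ
  refine (Integrable.of_integral_ne_zero (f := fun z : ℂ => Real.exp (-δ * ‖z‖ ^ (1 : ℝ)))
    ?_).congr (ae_of_all _ fun z => by simp)
  rw [h]
  have := Real.Gamma_pos_of_pos (show (0 : ℝ) < 2 / 1 + 1 by norm_num)
  positivity

lemma wishartWeight_hermMk_le {p : ℕ} (s : ℝ) {t : ℝ} (ht : 0 < t)
    (x : (Fin p → ℝ) × ({q : Fin p × Fin p // q.1 < q.2} → ℂ)) :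
    wishartWeight p s t (hermMk p x) ≤ (∏ q, Real.exp (-(t / 2 /
      (Fintype.card {q : Fin p × Fin p // q.1 < q.2} + 1) * ‖x.2 q‖))) *
        wishartWeight p s (t / 2) (hermMk p x) := by
  set N : ℝ := ((Fintype.card {q : Fin p × Fin p // q.1 < q.2} : ℕ) : ℝ) with hN
  by_cases h : (hermMk p x).PosDef
  swap
  · simp [wishartWeight, h]
  simp only [wishartWeight, if_pos h]
  rw [← mul_assoc, mul_comm (∏ q, _), mul_assoc]
  refine mul_le_mul_of_nonneg_left ?_ (Real.rpow_nonneg (det_re_pos h).le _)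
  rw [← Real.exp_sum, ← Real.exp_add]
  refine Real.exp_le_exp.2 ?_
  have hT : 0 ≤ (hermMk p x).trace.re := (Complex.nonneg_iff.1 h.posSemidef.trace_nonneg).1
  set T := (hermMk p x).trace.re
  have hN0 : 0 ≤ N := Nat.cast_nonneg _
  have hle : ∑ q, (t / 2 / (N + 1) * ‖x.2 q‖) ≤ N * (t / 2 / (N + 1) * T) := by
    rw [hN, Fintype.card, ← nsmul_eq_mul]
    refine Finset.sum_le_card_nsmul _ _ _ fun q _ => ?_
    refine mul_le_mul_of_nonneg_left ?_ (by positivity)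
    have := norm_apply_le_trace h q.2.ne
    have hq : hermMk p x q.1.1 q.1.2 = x.2 q := by simp [hermMk, q.2]
    rwa [hq] at this
  have hle2 : N * (t / 2 / (N + 1) * T) ≤ t / 2 * T := by
    have : N * (t / 2 / (N + 1) * T) = (N / (N + 1)) * (t / 2 * T) := by ring
    rw [this]
    exact mul_le_of_le_one_left (by positivity) ((div_le_one (by positivity)).2 (by linarith))
  rw [Finset.sum_neg_distrib]
  linarith

lemma integrable_wishartWeight {p : ℕ} {s t : ℝ} (hs : -1 < s) (ht : 0 < t) :
    Integrable fun x => wishartWeight p s t (hermMk p x) := by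
  obtain ⟨C, hCtop, hC⟩ := exists_lintegral_shifted_gamma_le hs (half_pos ht)
  have hm : ∀ t, Measurable fun x => wishartWeight p s t (hermMk p x) :=
    fun t => (measurable_wishartWeight p s t).comp (continuous_hermMk p).measurable
  set δ : ℝ := t / 2 / (Fintype.card {q : Fin p × Fin p // q.1 < q.2} + 1) with hδ
  have hδ0 : 0 < δ := by positivity
  set P : ({q : Fin p × Fin p // q.1 < q.2} → ℂ) → ℝ :=
    fun z => ∏ q, Real.exp (-(δ * ‖z q‖)) with hP
  have hPint : Integrable P := Integrable.fintype_prod (fun _ => integrable_exp_neg_mul_norm hδ0)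
  have hPm : Measurable P := by fun_prop
  have hP0 : ∀ z, 0 ≤ P z := fun z => Finset.prod_nonneg fun _ _ => (Real.exp_pos _).le
  refine ⟨(hm t).aestronglyMeasurable, ?_⟩
  rw [hasFiniteIntegral_iff_ofReal (ae_of_all _ fun x => wishartWeight_nonneg _ _ _ _),
    Measure.volume_eq_prod, lintegral_prod_symm' _ (hm t).ennreal_ofReal]
  calc _ ≤ ∫⁻ z, ENNReal.ofReal (P z) * C ^ p := ?_
    _ = (∫⁻ z, ENNReal.ofReal (P z)) * C ^ p := lintegral_mul_const _ hPm.ennreal_ofReal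
    _ < ∞ := ENNReal.mul_lt_top hPint.lintegral_lt_top (ENNReal.pow_lt_top hCtop.lt_top)
  refine lintegral_mono fun z => ?_
  refine le_trans ?_ (mul_le_mul_right (lintegral_fillDiag_le hC p (hermMk p (0, z))) _)
  rw [← lintegral_const_mul' _ _ ENNReal.ofReal_ne_top]
  refine lintegral_mono fun d => ?_
  rw [← ENNReal.ofReal_mul (hP0 z)]
  refine ENNReal.ofReal_le_ofReal ?_
  rw [← hermMk_eq_fillDiag p (d, z)]
  exact wishartWeight_hermMk_le s ht (d, z)

lemma integral_wishartWeight_pos {p : ℕ} {s t : ℝ} (hs : -1 < s) (ht : 0 < t) :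
    0 < ∫ x, wishartWeight p s t (hermMk p x) := by
  rw [integral_pos_iff_support_of_nonneg (fun x => wishartWeight_nonneg _ _ _ _)
    (integrable_wishartWeight hs ht)]
  have hone : hermMk p (fun _ => 1, 0) = 1 := by
    ext i j
    rcases lt_trichotomy i j with h | h | h
    · simp [hermMk, h, h.ne]
    · subst h
      simp [hermMk]
    · simp [hermMk, h, h.ne', h.not_gt]
  have hev : ∀ᶠ x in 𝓝 ((fun _ => 1, 0) :
      (Fin p → ℝ) × ({q : Fin p × Fin p // q.1 < q.2} → ℂ)), (hermMk p x).PosDef :=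
    eventually_posDef (isHermitian_hermMk p) ((continuous_hermMk p).tendsto _)
      (by rw [hone]; exact Matrix.PosDef.one)
  refine (Measure.measure_pos_of_mem_nhds volume hev).trans_le (measure_mono fun x hx => ?_)
  have hx : (hermMk p x).PosDef := hx
  have := det_re_pos hx
  rw [Function.mem_support, wishartWeight, if_pos hx]
  positivity

lemma integral_mnormalize_withDensity {p : ℕ} {w F : Matrix (Fin p) (Fin p) ℂ → ℝ}
    (hw : Measurable w) (hw0 : ∀ X, 0 ≤ w X) (hF : AEStronglyMeasurable F (hermLebesgue p)) :
    ∫ X, F X ∂(mnormalize ((hermLebesgue p).withDensity fun X => ENNReal.ofReal (w X))) =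
      (∫ x, w (hermMk p x))⁻¹ * ∫ x, w (hermMk p x) * F (hermMk p x) := by
  have hm : AEMeasurable (hermMk p) := (continuous_hermMk p).measurable.aemeasurable
  have h1 : (∫⁻ X, ENNReal.ofReal (w X) ∂(hermLebesgue p)).toReal = ∫ x, w (hermMk p x) := by
    rw [← integral_eq_lintegral_of_nonneg_ae (ae_of_all _ hw0) hw.aestronglyMeasurable,
      hermLebesgue, integral_map hm hw.aestronglyMeasurable]
  rw [mnormalize, integral_smul_measure, withDensity_apply _ MeasurableSet.univ,
    Measure.restrict_univ, ENNReal.toReal_inv, h1, smul_eq_mul,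
    integral_withDensity_eq_integral_toReal_smul hw.ennreal_ofReal
      (ae_of_all _ fun _ => ENNReal.ofReal_lt_top)]
  congr 1
  have h2 : ∀ X, (ENNReal.ofReal (w X)).toReal • F X = w X * F X := fun X => by
    rw [ENNReal.toReal_ofReal (hw0 X), smul_eq_mul]
  simp_rw [h2]
  rw [hermLebesgue, integral_map hm (f := fun X => w X * F X)
    (hw.aestronglyMeasurable.mul hF)]

/-- The unnormalized density of `a • X` for `X` distributed according to `Beta_p(s + p, a)`. -/
noncomputable def scaledBetaWeight (p : ℕ) (s a : ℝ) (X : Matrix (Fin p) (Fin p) ℂ) : ℝ :=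
  if X.PosDef ∧ (1 - a⁻¹ • X).PosDef then
    X.det.re ^ s * (1 - a⁻¹ • X).det.re ^ (a - p) else 0

lemma scaledBetaWeight_nonneg (p : ℕ) (s a : ℝ) (X : Matrix (Fin p) (Fin p) ℂ) :
    0 ≤ scaledBetaWeight p s a X := by
  unfold scaledBetaWeight
  split_ifs with h
  · have := det_re_pos h.1
    have := det_re_pos h.2
    positivity
  · exact le_rfl

lemma measurable_scaledBetaWeight (p : ℕ) (s a : ℝ) : Measurable (scaledBetaWeight p s a) := by
  have h : Measurable fun X : Matrix (Fin p) (Fin p) ℂ => 1 - a⁻¹ • X :=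
    Continuous.measurable (by fun_prop)
  exact Measurable.ite ((measurableSet_posDef p).inter (h (measurableSet_posDef p)))
    (((measurable_det_re p).pow_const s).mul (((measurable_det_re p).comp h).pow_const _))
    measurable_const

lemma posDef_smul_iff {p : ℕ} {a : ℝ} (ha : 0 < a) {X : Matrix (Fin p) (Fin p) ℂ} :
    (a • X).PosDef ↔ X.PosDef := by
  refine ⟨fun h => ?_, fun h => h.smul ha⟩
  have := h.smul (inv_pos.2 ha)
  rwa [smul_smul, inv_mul_cancel₀ ha.ne', one_smul] at this

lemma det_smul_re {p : ℕ} (a : ℝ) (X : Matrix (Fin p) (Fin p) ℂ) :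
    (a • X).det.re = a ^ p * X.det.re := by
  rw [← Complex.coe_smul, Matrix.det_smul, Fintype.card_fin, ← Complex.ofReal_pow,
    Complex.re_ofReal_mul]

lemma trace_smul_re {p : ℕ} (a : ℝ) (X : Matrix (Fin p) (Fin p) ℂ) :
    (a • X).trace.re = a * X.trace.re := by
  simp [Matrix.trace_smul]

lemma integral_matrixBeta {p : ℕ} {c a : ℝ} (ha : 0 < a) {F : Matrix (Fin p) (Fin p) ℂ → ℝ}
    (hF : AEStronglyMeasurable (fun X => F (a • X)) (hermLebesgue p)) :
    ∫ X, F (a • X) ∂(matrixBeta p c a) =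
      (∫ x, scaledBetaWeight p (c - p) a (hermMk p x))⁻¹ *
        ∫ x, scaledBetaWeight p (c - p) a (hermMk p x) * F (hermMk p x) := by
  set K : ℝ := ((a ^ p) ^ (c - p))⁻¹ with hK
  have hK0 : 0 < K := by positivity
  have hd : matrixBeta p c a = mnormalize ((hermLebesgue p).withDensity fun X =>
      ENNReal.ofReal (K * scaledBetaWeight p (c - p) a (a • X))) := by
    unfold matrixBeta
    congr 2
    ext X
    unfold scaledBetaWeight
    rw [smul_smul, inv_mul_cancel₀ ha.ne', one_smul, posDef_smul_iff ha]
    split_ifs with h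
    · rw [Real.rpow_eq_pow, Real.rpow_eq_pow, det_smul_re,
        Real.mul_rpow (by positivity) (det_re_pos h.1).le, ← mul_assoc, ← mul_assoc, hK,
        inv_mul_cancel₀ (by positivity), one_mul]
    · simp
  have hmeas : Measurable fun X : Matrix (Fin p) (Fin p) ℂ =>
      K * scaledBetaWeight p (c - p) a (a • X) :=
    ((measurable_scaledBetaWeight p (c - p) a).comp (measurable_const_smul a)).const_mul K
  rw [hd, integral_mnormalize_withDensity hmeas
    (fun X => mul_nonneg hK0.le (scaledBetaWeight_nonneg _ _ _ _)) hF]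
  simp_rw [mul_assoc, integral_const_mul, ← hermMk_smul]
  have : (volume : Measure
      ((Fin p → ℝ) × ({q : Fin p × Fin p // q.1 < q.2} → ℂ))).IsAddHaarMeasure :=
    Measure.prod.instIsAddHaarMeasure volume volume
  rw [Measure.integral_comp_smul volume (fun x => scaledBetaWeight p (c - p) a (hermMk p x)),
    Measure.integral_comp_smul volume (fun x => scaledBetaWeight p (c - p) a (hermMk p x) *
      F (hermMk p x)), smul_eq_mul, smul_eq_mul, ← mul_assoc K, ← mul_assoc K, mul_inv,
    mul_mul_mul_comm, inv_mul_cancel₀, one_mul]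
  have : a ^ Module.finrank ℝ ((Fin p → ℝ) × ({q : Fin p × Fin p // q.1 < q.2} → ℂ)) ≠ 0 :=
    pow_ne_zero _ ha.ne'
  exact mul_ne_zero hK0.ne' (abs_ne_zero.2 (inv_ne_zero this))

lemma scaledBetaWeight_le {p : ℕ} {s a : ℝ} (ha : 0 < a) (hap : 2 * p ≤ a)
    (X : Matrix (Fin p) (Fin p) ℂ) :
    scaledBetaWeight p s a X ≤ wishartWeight p s (1 / 2) X := by
  by_cases h : X.PosDef ∧ (1 - a⁻¹ • X).PosDef
  swap
  · rw [scaledBetaWeight, if_neg h]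
    exact wishartWeight_nonneg _ _ _ _
  rw [scaledBetaWeight, if_pos h, wishartWeight, if_pos h.1]
  refine mul_le_mul_of_nonneg_left ?_ (Real.rpow_nonneg (det_re_pos h.1).le _)
  have hp : (0 : ℝ) ≤ p := Nat.cast_nonneg p
  refine (Real.rpow_le_rpow (det_re_pos h.2).le (det_re_le_exp h.2) (by linarith)).trans ?_
  rw [← Real.exp_mul, sub_sub_cancel_left, Matrix.trace_neg, Complex.neg_re, trace_smul_re]
  refine Real.exp_le_exp.2 ?_
  have hT : 0 ≤ X.trace.re := (Complex.nonneg_iff.1 h.1.posSemidef.trace_nonneg).1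
  have h2 : 1 / 2 ≤ a⁻¹ * (a - p) := by
    rw [inv_mul_eq_div, le_div_iff₀ ha]
    linarith
  nlinarith

lemma tendsto_det_one_sub_inv_smul_rpow {p : ℕ} (X : Matrix (Fin p) (Fin p) ℂ) :
    Tendsto (fun a : ℝ => (1 - a⁻¹ • X).det.re ^ (a - p)) atTop
      (𝓝 (Real.exp (-X.trace.re))) := by
  set g : ℝ → ℝ := fun a => (1 - a⁻¹ • X).det.re - 1 with hg
  obtain ⟨P, hP⟩ : ∃ P : Polynomial ℂ, ∀ r : ℂ,
      (1 + r • X).det = 1 + X.trace * r + P.eval r * r ^ 2 := ⟨_, fun r => Matrix.det_one_add_smul r X⟩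
  have hinv : Tendsto (fun a : ℝ => ((-a⁻¹ : ℝ) : ℂ)) atTop (𝓝 0) := by
    have := (Complex.continuous_ofReal.tendsto 0).comp
      (by simpa using (tendsto_inv_atTop_zero (𝕜 := ℝ)).neg :
        Tendsto (fun a : ℝ => -a⁻¹) atTop (𝓝 0))
    simpa [Function.comp_def] using this
  have hlim : Tendsto (fun a : ℝ => a * g a) atTop (𝓝 (-X.trace.re)) := by
    have h1 : Tendsto (fun a : ℝ => (-(X.trace) - P.eval ((-a⁻¹ : ℝ) : ℂ) * ((-a⁻¹ : ℝ) : ℂ)).re)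
        atTop (𝓝 (-X.trace.re)) := by
      have h2 := ((P.continuous.tendsto 0).comp hinv).mul hinv
      have h3 := (Complex.continuous_re.tendsto _).comp (h2.const_sub (-X.trace))
      simpa [Function.comp_def] using h3
    refine h1.congr' ?_
    filter_upwards [eventually_gt_atTop 0] with a ha
    have e1 : (1 - a⁻¹ • X) = 1 + ((-a⁻¹ : ℝ) : ℂ) • X := by
      rw [Complex.coe_smul, neg_smul, sub_eq_add_neg]
    rw [hg]
    simp only
    rw [e1, hP, ← Complex.one_re, ← Complex.sub_re, ← Complex.re_ofReal_mul]
    congr 1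
    have : (a : ℂ) ≠ 0 := by exact_mod_cast ha.ne'
    push_cast
    field_simp
    ring
  have hpow := Real.tendsto_one_add_rpow_exp_of_tendsto hlim
  have hg0 : Tendsto (fun a => 1 + g a) atTop (𝓝 1) := by
    have h := hlim.mul tendsto_inv_atTop_zero
    rw [mul_zero] at h
    have h' : Tendsto g atTop (𝓝 0) := by
      refine h.congr' ?_
      filter_upwards [eventually_gt_atTop 0] with a ha
      field_simp
    simpa using h'.const_add 1
  have hp : Tendsto (fun a => (1 + g a) ^ (p : ℝ)) atTop (𝓝 1) := by
    simpa using hg0.rpow_const (p := (p : ℝ)) (Or.inl one_ne_zero)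
  have hq := hpow.div hp one_ne_zero
  rw [div_one] at hq
  refine hq.congr' ?_
  filter_upwards [hg0.eventually_const_lt zero_lt_one] with a ha
  rw [Pi.div_apply, ← Real.rpow_sub ha]
  simp [hg]

lemma tendsto_scaledBetaWeight {p : ℕ} (s : ℝ) {X : Matrix (Fin p) (Fin p) ℂ} :
    Tendsto (fun a => scaledBetaWeight p s a X) atTop (𝓝 (wishartWeight p s 1 X)) := by
  by_cases h : X.PosDef
  swap
  · simp [scaledBetaWeight, wishartWeight, h]
  have hev : ∀ᶠ a : ℝ in atTop, (1 - a⁻¹ • X).PosDef := by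
    refine eventually_posDef (X := 1) (fun a => ?_) ?_ Matrix.PosDef.one
    · refine Matrix.isHermitian_one.sub ?_
      rw [Matrix.IsHermitian, Matrix.conjTranspose_smul, h.isHermitian.eq, star_trivial]
    · simpa using ((tendsto_inv_atTop_zero (𝕜 := ℝ)).smul_const X).const_sub
        (1 : Matrix (Fin p) (Fin p) ℂ)
  rw [wishartWeight, if_pos h, one_mul]
  refine ((tendsto_det_one_sub_inv_smul_rpow X).const_mul (X.det.re ^ s)).congr' ?_
  filter_upwards [hev] with a ha
  rw [scaledBetaWeight, if_pos ⟨h, ha⟩]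

lemma tendsto_integral_scaledBetaWeight {p : ℕ} {s : ℝ} (hs : -1 < s) {a : ℕ → ℝ}
    (hpos : ∀ n, 0 < a n) (ha : Tendsto a atTop atTop)
    (f : BoundedContinuousFunction (Matrix (Fin p) (Fin p) ℂ) ℝ) :
    Tendsto (fun n => ∫ x, scaledBetaWeight p s (a n) (hermMk p x) * f (hermMk p x)) atTop
      (𝓝 (∫ x, wishartWeight p s 1 (hermMk p x) * f (hermMk p x))) := by
  have hm := (continuous_hermMk p).measurable
  refine tendsto_integral_filter_of_dominated_convergence
    (fun x => wishartWeight p s (1 / 2) (hermMk p x) * ‖f‖) ?_ ?_ ?_ ?_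
  · exact Eventually.of_forall fun n =>
      ((measurable_scaledBetaWeight p s (a n)).comp hm).aestronglyMeasurable.mul
        (f.continuous.comp (continuous_hermMk p)).aestronglyMeasurable
  · filter_upwards [ha.eventually_ge_atTop (2 * p)] with n hn
    refine ae_of_all _ fun x => ?_
    rw [norm_mul, Real.norm_of_nonneg (scaledBetaWeight_nonneg _ _ _ _)]
    exact mul_le_mul (scaledBetaWeight_le (hpos n) hn _) (f.norm_coe_le_norm _) (norm_nonneg _)
      (wishartWeight_nonneg _ _ _ _)
  · exact (integrable_wishartWeight hs one_half_pos).mul_const _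
  · exact ae_of_all _ fun x => ((tendsto_scaledBetaWeight s).comp ha).mul_const _

/-- If `X_n ~ Beta_p(c, a_n)` with `c > p - 1` fixed and `a_n → ∞`, then `a_n X_n`
converges in distribution to the complex Wishart distribution `W_p(c)`. -/
theorem matrixBeta_tendsto_wishart (p : ℕ) (c : ℝ) (hc : (p : ℝ) - 1 < c)
    (a : ℕ → ℝ) (hpos : ∀ n, 0 < a n) (ha : Tendsto a atTop atTop) :
    TendstoInDistribution
      (fun n => Measure.map
        (fun X : Matrix (Fin p) (Fin p) ℂ => a n • X)
        (matrixBeta p c (a n)))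
      (wishart p c) := by
  intro f
  have hs : -1 < c - p := by linarith
  have hf : Continuous fun X : Matrix (Fin p) (Fin p) ℂ => f X := f.continuous
  have hbeta : ∀ n, ∫ X, f X ∂(Measure.map (fun X : Matrix (Fin p) (Fin p) ℂ => a n • X)
      (matrixBeta p c (a n))) = (∫ x, scaledBetaWeight p (c - p) (a n) (hermMk p x))⁻¹ *
        ∫ x, scaledBetaWeight p (c - p) (a n) (hermMk p x) * f (hermMk p x) := by
    intro n
    rw [integral_map (measurable_const_smul (a n)).aemeasurable hf.aestronglyMeasurable,
      integral_matrixBeta (hpos n) (F := fun X => f X)]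
    exact (hf.comp (continuous_const_smul (a n))).aestronglyMeasurable
  have hwish : ∫ X, f X ∂(wishart p c) = (∫ x, wishartWeight p (c - p) 1 (hermMk p x))⁻¹ *
        ∫ x, wishartWeight p (c - p) 1 (hermMk p x) * f (hermMk p x) := by
    have hd : wishart p c = mnormalize ((hermLebesgue p).withDensity fun X =>
        ENNReal.ofReal (wishartWeight p (c - p) 1 X)) := by
      unfold wishart
      congr 2
      ext X
      unfold wishartWeight
      split_ifs <;> simp
    rw [hd, integral_mnormalize_withDensity (measurable_wishartWeight _ _ _)
      (wishartWeight_nonneg _ _ _) hf.aestronglyMeasurable]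
  simp_rw [hbeta]
  rw [hwish]
  refine Tendsto.mul (Tendsto.inv₀ ?_ (integral_wishartWeight_pos hs one_pos).ne') ?_
  · simpa using tendsto_integral_scaledBetaWeight hs hpos ha (1 : BoundedContinuousFunction _ ℝ)
  · exact tendsto_integral_scaledBetaWeight hs hpos ha f
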